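/- (Double robustness of ψ1, correctly specified outcome, i = 1) Under the noise condition E[ξ | σ(D,Z)] = 0 a.s. and D ∈ {0,1} a.s., for every measurable function m : E → ℝ (a possibly misspecified propensity score) satisfying ε ≤ m(Z) ≤ 1 − ε a.s. for some ε ∈ (0, 1/2), one has E[g0(1, Z) + D · (Y − g0(1, Z)) / m(Z)] = E[g0(1, Z)] = θ0^1. That is, the estimator derived from the score ψ1 remains consistent for θ0^1 even when the propensity score is misspecified, as long as the outcome model g0 is correct. -/

import Mathlib

open MeasureTheory ProbabilityTheory

/-- A weight measurable with respect to `m` is orthogonal to any integrable function whose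
conditional expectation given `m` vanishes. -/
theorem integral_mul_eq_zero_of_condExp_eq_zero {Ω : Type*} {m m0 : MeasurableSpace Ω}
    {μ : Measure Ω} [IsFiniteMeasure μ] (hm : m ≤ m0) {w f : Ω → ℝ}
    (hw : StronglyMeasurable[m] w) (hwf : Integrable (w * f) μ) (hf : Integrable f μ)
    (hf0 : μ[f | m] =ᵐ[μ] 0) : ∫ ω, w ω * f ω ∂μ = 0 := by
  have h : μ[w * f | m] =ᵐ[μ] 0 := by
    filter_upwards [condExp_mul_of_stronglyMeasurable_left hw hwf hf, hf0] with ω h1 h2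
    simp [h1, h2]
  calc ∫ ω, w ω * f ω ∂μ = ∫ ω, (μ[w * f | m]) ω ∂μ := (integral_condExp hm).symm
    _ = 0 := integral_eq_zero_of_ae h

/-- Double robustness of ψ1, correctly specified outcome, i = 1: Under the noise
condition `E[ξ | σ(D,Z)] = 0` a.s. and `D ∈ {0,1}` a.s., for every measurable `m : E → ℝ` with
`ε ≤ m(Z) ≤ 1 − ε` a.s. for some `ε ∈ (0, 1/2)`,
`E[g0(1, Z) + D · (Y − g0(1, Z)) / m(Z)] = E[g0(1, Z)] = θ0^1`. -/
theorem stmt_12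
    {Ω : Type*} [MeasurableSpace Ω] (P : Measure Ω) [IsProbabilityMeasure P]
    {E : Type*} [MeasurableSpace E]
    (Z : Ω → E) (hZ : Measurable Z)
    (D : Ω → ℝ) (hD : Measurable D) (hD01 : ∀ᵐ ω ∂P, D ω = 0 ∨ D ω = 1)
    (Y : Ω → ℝ) (hY : Integrable Y P)
    (g0 : ℝ × E → ℝ) (hg0 : Measurable g0)
    (hg0int : Integrable (fun ω => g0 (D ω, Z ω)) P)
    (hg1int : Integrable (fun ω => g0 (1, Z ω)) P)
    (hxi : P[fun ω => Y ω - g0 (D ω, Z ω) |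
        MeasurableSpace.comap (fun ω => (D ω, Z ω)) inferInstance] =ᵐ[P] 0) :
    ∀ m : E → ℝ, Measurable m →
      ∀ ε : ℝ, ε ∈ Set.Ioo (0 : ℝ) (1 / 2) →
        (∀ᵐ ω ∂P, ε ≤ m (Z ω) ∧ m (Z ω) ≤ 1 - ε) →
        ∫ ω, (g0 (1, Z ω) + D ω * (Y ω - g0 (1, Z ω)) / m (Z ω)) ∂P =
          ∫ ω, g0 (1, Z ω) ∂P := by
  intro m hm ε hε hmε
  have hDZ : Measurable fun ω => (D ω, Z ω) := hD.prodMk hZ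
  have hξ : Integrable (fun ω => Y ω - g0 (D ω, Z ω)) P := hY.sub hg0int
  have hbound : ∀ᵐ ω ∂P, ‖D ω / m (Z ω)‖ ≤ 1 / ε := by
    filter_upwards [hD01, hmε] with ω hd ⟨hlo, _⟩
    have hmpos : 0 < m (Z ω) := hε.1.trans_le hlo
    rcases hd with hd | hd
    · simpa [hd] using hε.1.le
    · rw [hd, Real.norm_of_nonneg (by positivity)]
      exact one_div_le_one_div_of_le hε.1 hlo
  have hint : Integrable (fun ω => D ω / m (Z ω) * (Y ω - g0 (D ω, Z ω))) P :=
    hξ.bdd_mul (hD.div (hm.comp hZ)).aestronglyMeasurable hbound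
  have hweight : StronglyMeasurable[MeasurableSpace.comap (fun ω => (D ω, Z ω)) inferInstance]
      fun ω => D ω / m (Z ω) :=
    ((measurable_fst.div (hm.comp measurable_snd)).comp
      (comap_measurable fun ω => (D ω, Z ω))).stronglyMeasurable
  have hcorr : (fun ω => g0 (1, Z ω) + D ω * (Y ω - g0 (1, Z ω)) / m (Z ω)) =ᵐ[P]
      fun ω => g0 (1, Z ω) + D ω / m (Z ω) * (Y ω - g0 (D ω, Z ω)) := by
    filter_upwards [hD01] with ω hd
    rcases hd with hd | hd
    · simp [hd]
    · rw [hd]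
      ring
  rw [integral_congr_ae hcorr, integral_add hg1int hint,
    integral_mul_eq_zero_of_condExp_eq_zero hDZ.comap_le hweight hint hξ hxi, add_zero]
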